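/- There exists a constant C > 0 such that for every twice continuously differentiable vector field u : ℝ³ → ℝ³ with compact support, the trilinear term satisfies |∫_{ℝ³} Σ_{i,j=1}^{3} u_j(x) (∂_j u_i)(x) (Δu_i)(x) dx| ≤ C ‖∇u‖_{L²}^{3/2} ‖Δu‖_{L²}^{3/2}. -/

import Mathlib

open MeasureTheory

/-- The partial derivative of `f` in the `k`-th coordinate direction. -/
noncomputable def partialDeriv {ι : Type*} [Fintype ι] [DecidableEq ι] (k : ι)
    (f : (ι → ℝ) → ℝ) (x : ι → ℝ) : ℝ :=
  fderiv ℝ f x (Pi.single k 1)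

section FirstOrder

open Filter Topology

variable {E : Type*} [NormedAddCommGroup E] [NormedSpace ℝ E] [FiniteDimensional ℝ E]
  [MeasurableSpace E] [BorelSpace E] (μ : Measure E) [μ.IsAddHaarMeasure]

/-- Difference quotients may be moved from one factor to the other while a derivative is moved
the other way. -/
lemma integral_diffQuot_mul_fderiv {a b : E → ℝ} (ha : ContDiff ℝ 1 a) (hb : ContDiff ℝ 1 b)
    (hca : HasCompactSupport a) (hcb : HasCompactSupport b) (v w : E) (t : ℝ) :
    ∫ x, (t⁻¹ • (b (x + t • v) - b x)) * fderiv ℝ a x w ∂μ =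
      -∫ x, (t⁻¹ • (a (x + t • (-v)) - a x)) * fderiv ℝ b x w ∂μ := by
  have hb' : Continuous fun x => fderiv ℝ b x w :=
    (hb.continuous_fderiv one_ne_zero).clm_apply continuous_const
  have ha' : Continuous fun x => fderiv ℝ a x w :=
    (ha.continuous_fderiv one_ne_zero).clm_apply continuous_const
  have hcb' : HasCompactSupport fun x => fderiv ℝ b x w := hcb.fderiv_apply ℝ w
  have hD : ContDiff ℝ 1 fun x => b (x + t • v) := hb.comp (contDiff_id.add contDiff_const)
  have hshift : ∫ x, fderiv ℝ b (x + t • v) w * a x ∂μ =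
      ∫ x, fderiv ℝ b x w * a (x + t • (-v)) ∂μ := by
    rw [← integral_add_right_eq_self (fun x => fderiv ℝ b x w * a (x + t • (-v))) (t • v)]
    simp
  have hparts : ∫ x, (b (x + t • v) - b x) * fderiv ℝ a x w ∂μ =
      -∫ x, (fderiv ℝ b (x + t • v) w - fderiv ℝ b x w) * a x ∂μ := by
    have hdd : ∀ x, fderiv ℝ (fun y => b (y + t • v) - b y) x w =
        fderiv ℝ b (x + t • v) w - fderiv ℝ b x w := fun x => by
      rw [fderiv_fun_sub (hD.differentiable one_ne_zero x) (hb.differentiable one_ne_zero x),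
        fderiv_comp_add_right]
      rfl
    simp_rw [← hdd]
    apply integral_mul_fderiv_eq_neg_fderiv_mul_of_integrable
    · simp_rw [hdd]
      refine Continuous.integrable_of_hasCompactSupport ?_ hca.mul_left
      exact ((hb'.comp (continuous_add_const _)).sub hb').mul ha.continuous
    · exact ((hD.continuous.sub hb.continuous).mul ha').integrable_of_hasCompactSupport
        (hca.fderiv_apply ℝ w).mul_left
    · exact ((hD.continuous.sub hb.continuous).mul ha.continuous).integrable_of_hasCompactSupport
        hca.mul_left
    · exact fun x _ => (hD.sub hb).differentiable one_ne_zero x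
    · exact fun x _ => ha.differentiable one_ne_zero x
  simp_rw [smul_eq_mul, mul_assoc, integral_const_mul]
  rw [hparts, ← mul_neg]
  congr 2
  simp_rw [sub_mul]
  rw [integral_sub, integral_sub, hshift]
  · simp_rw [mul_comm]
  · exact ((ha.continuous.comp (continuous_add_const _)).mul hb').integrable_of_hasCompactSupport
      hcb'.mul_left
  · exact (ha.continuous.mul hb').integrable_of_hasCompactSupport hcb'.mul_left
  · exact ((hb'.comp (continuous_add_const _)).mul ha.continuous).integrable_of_hasCompactSupport
      hca.mul_left
  · exact (hb'.mul ha.continuous).integrable_of_hasCompactSupport hca.mul_left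

lemma integral_fderiv_mul_fderiv_comm {a b : E → ℝ} (ha : ContDiff ℝ 1 a) (hb : ContDiff ℝ 1 b)
    (hca : HasCompactSupport a) (hcb : HasCompactSupport b) (v w : E) :
    ∫ x, fderiv ℝ b x v * fderiv ℝ a x w ∂μ = ∫ x, fderiv ℝ a x v * fderiv ℝ b x w ∂μ := by
  have key : ∀ {f g : E → ℝ}, ContDiff ℝ 1 f → ContDiff ℝ 1 g → HasCompactSupport f →
      HasCompactSupport g → ∀ v, Tendsto
        (fun t : ℝ => ∫ x, (t⁻¹ • (f (x + t • v) - f x)) * fderiv ℝ g x w ∂μ) (𝓝[>] 0)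
        (𝓝 (∫ x, fderiv ℝ f x v * fderiv ℝ g x w ∂μ)) := by
    intro f g hf hg hcf hcg v
    obtain ⟨K, hK⟩ := hf.lipschitzWith_of_hasCompactSupport hcf one_ne_zero
    have hgi : Integrable (fun x => fderiv ℝ g x w) μ :=
      ((hg.continuous_fderiv one_ne_zero).clm_apply
        continuous_const).integrable_of_hasCompactSupport (hcg.fderiv_apply ℝ w)
    have := hK.integral_inv_smul_sub_mul_tendsto_integral_lineDeriv_mul hgi v
    simpa only [(hf.differentiable one_ne_zero _).lineDeriv_eq_fderiv] using this
  have h₁ := key hb ha hcb hca v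
  have h₂ := (key ha hb hca hcb (-v)).neg
  simp_rw [integral_diffQuot_mul_fderiv μ ha hb hca hcb] at h₁
  rw [tendsto_nhds_unique h₁ h₂]
  simp [integral_neg]

end FirstOrder

section Partial

variable {ι : Type*} [Fintype ι] [DecidableEq ι] {f : (ι → ℝ) → ℝ}

lemma ContDiff.partialDeriv {m n : WithTop ℕ∞} (hf : ContDiff ℝ n f) (hmn : m + 1 ≤ n) (k : ι) :
    ContDiff ℝ m (partialDeriv k f) :=
  (hf.fderiv_right hmn).clm_apply contDiff_const

lemma HasCompactSupport.partialDeriv (hf : HasCompactSupport f) (k : ι) :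
    HasCompactSupport (partialDeriv k f) :=
  hf.fderiv_apply ℝ _

lemma partialDeriv_comm (hf : ContDiff ℝ 2 f) (j k : ι) (x : ι → ℝ) :
    partialDeriv j (partialDeriv k f) x = partialDeriv k (partialDeriv j f) x := by
  have hd : DifferentiableAt ℝ (fderiv ℝ f) x :=
    (hf.fderiv_right (m := 1) (by norm_num)).differentiable one_ne_zero x
  have h : ∀ i l : ι, partialDeriv i (partialDeriv l f) x =
      fderiv ℝ (fderiv ℝ f) x (Pi.single i 1) (Pi.single l 1) := fun i l => by
    unfold partialDeriv
    rw [fderiv_clm_apply hd (differentiableAt_const _)]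
    simp
  rw [h, h]
  exact (hf.contDiffAt.isSymmSndFDerivAt (by simp)) _ _

/-- The Hessian and the Laplacian of a compactly supported `C²` function have the same
`L²` norm. -/
lemma sum_integral_sq_partialDeriv_partialDeriv (hf : ContDiff ℝ 2 f) (hc : HasCompactSupport f) :
    ∑ j, ∑ k, ∫ x, partialDeriv k (partialDeriv j f) x ^ 2 =
      ∫ x, (∑ k, partialDeriv k (partialDeriv k f) x) ^ 2 := by
  have h1 : ∀ k, ContDiff ℝ 1 (partialDeriv k f) := fun k => hf.partialDeriv (by norm_num) k
  have h2 : ∀ j k, Continuous (partialDeriv j (partialDeriv k f)) :=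
    fun j k => ((h1 k).partialDeriv (m := 0) (by norm_num) j).continuous
  have hi : ∀ j k, Integrable fun x =>
      partialDeriv j (partialDeriv j f) x * partialDeriv k (partialDeriv k f) x := fun j k =>
    ((h2 j j).mul (h2 k k)).integrable_of_hasCompactSupport
      ((hc.partialDeriv k).partialDeriv k).mul_left
  simp_rw [pow_two (∑ k, _), Finset.sum_mul_sum]
  rw [integral_finsetSum _ fun j _ => integrable_finsetSum _ fun k _ => hi j k]
  refine Finset.sum_congr rfl fun j _ => ?_
  rw [integral_finsetSum _ fun k _ => hi j k]
  refine Finset.sum_congr rfl fun k _ => ?_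
  have := integral_fderiv_mul_fderiv_comm volume (h1 k) (h1 j) (hc.partialDeriv k)
    (hc.partialDeriv j) (Pi.single k 1) (Pi.single j 1)
  calc ∫ x, partialDeriv k (partialDeriv j f) x ^ 2
      = ∫ x, partialDeriv k (partialDeriv j f) x * partialDeriv j (partialDeriv k f) x := by
        simp_rw [partialDeriv_comm hf j k, pow_two]
    _ = ∫ x, partialDeriv k (partialDeriv k f) x * partialDeriv j (partialDeriv j f) x := this
    _ = _ := by simp_rw [mul_comm]

end Partial

section Estimates

open scoped ENNReal NNReal

/-- Hölder's inequality with exponents `6, 3, 2`, the `L³` norm being interpolated between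
`L²` and `L⁶`. -/
lemma lintegral_enorm_mul_mul_le {α : Type*} [MeasurableSpace α] {μ : Measure α} {v w z : α → ℝ}
    (hv : AEMeasurable v μ) (hw : AEMeasurable w μ) (hz : AEMeasurable z μ) :
    ∫⁻ x, ‖v x * w x * z x‖ₑ ∂μ ≤
      eLpNorm v 6 μ * eLpNorm w 2 μ ^ (1 / 2 : ℝ) * eLpNorm w 6 μ ^ (1 / 2 : ℝ) *
        eLpNorm z 2 μ := by
  have h := ENNReal.lintegral_prod_norm_pow_le (μ := μ) Finset.univ
    (f := ![fun x => ‖v x‖ₑ ^ (6 : ℝ), fun x => ‖w x‖ₑ ^ (2 : ℝ), fun x => ‖w x‖ₑ ^ (6 : ℝ),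
      fun x => ‖z x‖ₑ ^ (2 : ℝ)]) (p := ![1 / 6, 1 / 4, 1 / 12, 1 / 2])
    (by
      intro i _
      fin_cases i
      exacts [hv.enorm.pow_const _, hw.enorm.pow_const _, hw.enorm.pow_const _,
        hz.enorm.pow_const _])
    (by simp [Fin.sum_univ_four]; norm_num)
    (by intro i _; fin_cases i <;> norm_num)
  simp only [Fin.prod_univ_four, Matrix.cons_val, ← ENNReal.rpow_mul] at h
  norm_num at h
  have hint : ∀ x, ‖v x * w x * z x‖ₑ =
      ‖v x‖ₑ * ‖w x‖ₑ ^ (1 / 2 : ℝ) * ‖w x‖ₑ ^ (1 / 2 : ℝ) * ‖z x‖ₑ := fun x => by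
    rw [mul_assoc ‖v x‖ₑ, ← ENNReal.rpow_add_of_nonneg _ _ (by norm_num) (by norm_num)]
    norm_num
  simp_rw [hint, eLpNorm_eq_lintegral_rpow_enorm_toReal (p := 6) (by norm_num) (by norm_num),
    eLpNorm_eq_lintegral_rpow_enorm_toReal (p := 2) (by norm_num) (by norm_num),
    ← ENNReal.rpow_mul]
  norm_num
  exact h

lemma eLpNorm_two_eq_ofReal_sqrt {α : Type*} [MeasurableSpace α] {μ : Measure α} {z : α → ℝ}
    (hz : MemLp z 2 μ) : eLpNorm z 2 μ = ENNReal.ofReal √(∫ x, z x ^ 2 ∂μ) := by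
  rw [hz.eLpNorm_eq_integral_rpow_norm (by norm_num) (by norm_num), Real.sqrt_eq_rpow]
  simp

/-- The Sobolev inequality `‖g‖_{L⁶} ≤ C ‖∇g‖_{L²}` on `ℝ³`. -/
lemma exists_eLpNorm_six_le :
    ∃ K : ℝ, 0 < K ∧ ∀ g : (Fin 3 → ℝ) → ℝ, ContDiff ℝ 1 g → HasCompactSupport g →
      ∀ S, ∑ k, ∫ x, partialDeriv k g x ^ 2 ≤ S →
        eLpNorm g 6 volume ≤ ENNReal.ofReal (K * √S) := by
  set K := SNormLESNormFDerivOfEqConst ℝ (volume : Measure (Fin 3 → ℝ)) 2 with hK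
  refine ⟨K * 3 + 1, by positivity, fun g hg hc S hS => ?_⟩
  have hsob := eLpNorm_le_eLpNorm_fderiv_of_eq (volume : Measure (Fin 3 → ℝ)) hg hc
    (p := 2) (p' := 6) (by norm_num) (by simp) (by simp; norm_num)
  have hcont : ∀ k, Continuous (partialDeriv k g) :=
    fun k => (hg.partialDeriv (m := 0) (by norm_num) k).continuous
  have hmem : ∀ k, MemLp (partialDeriv k g) 2 volume :=
    fun k => (hcont k).memLp_of_hasCompactSupport (hc.partialDeriv k)
  have hnorm : ∀ x, ‖fderiv ℝ g x‖ ≤ ∑ k, ‖partialDeriv k g x‖ := fun x => by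
    refine ContinuousLinearMap.opNorm_le_bound _ (by positivity) fun y => ?_
    have hy : fderiv ℝ g x y = ∑ k, y k * partialDeriv k g x := by
      conv_lhs => rw [pi_eq_sum_univ' y]
      simp [partialDeriv]
    rw [hy, Finset.sum_mul]
    refine (norm_sum_le _ _).trans (Finset.sum_le_sum fun k _ => ?_)
    rw [norm_mul, mul_comm]
    gcongr
    exact norm_le_pi_norm y k
  have hgrad : eLpNorm (fderiv ℝ g) 2 volume ≤ ENNReal.ofReal (3 * √S) :=
    calc eLpNorm (fderiv ℝ g) 2 volume
        ≤ eLpNorm (∑ k, fun x => ‖partialDeriv k g x‖) 2 volume :=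
          eLpNorm_mono_real fun x => by simpa using hnorm x
      _ ≤ ∑ k, eLpNorm (fun x => ‖partialDeriv k g x‖) 2 volume :=
          eLpNorm_sum_le (fun k _ => (hcont k).norm.aestronglyMeasurable) (by norm_num)
      _ ≤ ∑ k : Fin 3, ENNReal.ofReal √S := by
          refine Finset.sum_le_sum fun k _ => ?_
          rw [eLpNorm_norm, eLpNorm_two_eq_ofReal_sqrt (hmem k)]
          gcongr
          exact (Finset.single_le_sum (f := fun k => ∫ x, partialDeriv k g x ^ 2)
            (fun k _ => integral_nonneg fun x => sq_nonneg _) (Finset.mem_univ k)).trans hS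
      _ = ENNReal.ofReal (3 * √S) := by
          rw [ENNReal.ofReal_mul (by norm_num)]
          simp
  calc eLpNorm g 6 volume ≤ K * eLpNorm (fderiv ℝ g) 2 volume := by simpa [hK] using hsob
    _ ≤ K * ENNReal.ofReal (3 * √S) := by gcongr
    _ = ENNReal.ofReal (K * (3 * √S)) := by
        rw [ENNReal.ofReal_mul K.coe_nonneg, ENNReal.ofReal_coe_nnreal]
    _ ≤ ENNReal.ofReal ((K * 3 + 1) * √S) := by
        refine ENNReal.ofReal_le_ofReal ?_
        nlinarith [Real.sqrt_nonneg S]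

lemma sqrt_mul_interpolation_eq {K D L : ℝ} (hK : 0 ≤ K) (hD : 0 ≤ D) (hL : 0 ≤ L) :
    K * √D * √D ^ (1 / 2 : ℝ) * (K * √L) ^ (1 / 2 : ℝ) * √L =
      K ^ (3 / 2 : ℝ) * D ^ (3 / 4 : ℝ) * L ^ (3 / 4 : ℝ) := by
  have h : ∀ {y : ℝ}, 0 ≤ y → √y * √y ^ (1 / 2 : ℝ) = y ^ (3 / 4 : ℝ) := fun {y} hy => by
    rw [Real.sqrt_eq_rpow, ← Real.rpow_mul hy, ← Real.rpow_add_of_nonneg hy] <;> norm_num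
  have hK' : K * K ^ (1 / 2 : ℝ) = K ^ (3 / 2 : ℝ) := by
    nth_rw 1 [← Real.rpow_one K]
    rw [← Real.rpow_add_of_nonneg hK] <;> norm_num
  rw [← h hD, ← h hL, ← hK', Real.mul_rpow hK (Real.sqrt_nonneg _)]
  ring

end Estimates


/-- The trilinear estimate `|((u·∇)u, Δu)| ≤ C ‖∇u‖_{L²}^{3/2} ‖Δu‖_{L²}^{3/2}` for
compactly supported `C²` vector fields on `ℝ³`. -/
theorem trilinear_estimate :
    ∃ C : ℝ, 0 < C ∧
      ∀ u : (Fin 3 → ℝ) → (Fin 3 → ℝ),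
        ContDiff ℝ 2 u → HasCompactSupport u →
        |∫ x : Fin 3 → ℝ, ∑ i : Fin 3, ∑ j : Fin 3,
            u x j * (fderiv ℝ (fun y => u y i) x (Pi.single j 1)) *
              (∑ k : Fin 3,
                fderiv ℝ (fun y => fderiv ℝ (fun z => u z i) y (Pi.single k 1)) x
                  (Pi.single k 1))| ≤
        C * (∫ x : Fin 3 → ℝ, ∑ i : Fin 3, ∑ j : Fin 3,
                (fderiv ℝ (fun y => u y i) x (Pi.single j 1)) ^ 2) ^ ((3:ℝ)/4) *
            (∫ x : Fin 3 → ℝ, ∑ i : Fin 3,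
                (∑ k : Fin 3,
                  fderiv ℝ (fun y => fderiv ℝ (fun z => u z i) y (Pi.single k 1)) x
                    (Pi.single k 1)) ^ 2) ^ ((3:ℝ)/4) := by
  obtain ⟨K, hK, hsob⟩ := exists_eLpNorm_six_le
  refine ⟨9 * K ^ (3 / 2 : ℝ), by positivity, fun u hu hc => ?_⟩
  let f : Fin 3 → (Fin 3 → ℝ) → ℝ := fun i x => u x i
  let lap : Fin 3 → (Fin 3 → ℝ) → ℝ := fun i x => ∑ k, partialDeriv k (partialDeriv k (f i)) x
  change |∫ x, ∑ i, ∑ j, f j x * partialDeriv j (f i) x * lap i x| ≤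
    9 * K ^ (3 / 2 : ℝ) * (∫ x, ∑ i, ∑ j, partialDeriv j (f i) x ^ 2) ^ (3 / 4 : ℝ) *
      (∫ x, ∑ i, lap i x ^ 2) ^ (3 / 4 : ℝ)
  have hf : ∀ i, ContDiff ℝ 2 (f i) := fun i => contDiff_pi.1 hu i
  have hcf : ∀ i, HasCompactSupport (f i) := fun i =>
    hc.comp_left (g := fun y : Fin 3 → ℝ => y i) rfl
  have hpd : ∀ i j, ContDiff ℝ 1 (partialDeriv j (f i)) :=
    fun i j => (hf i).partialDeriv (by norm_num) j
  have hcpd : ∀ i j, HasCompactSupport (partialDeriv j (f i)) := fun i j => (hcf i).partialDeriv j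
  have hlap : ∀ i, Continuous (lap i) := fun i => continuous_finsetSum _ fun k _ =>
    ((hpd i k).partialDeriv (m := 0) (by norm_num) k).continuous
  have hclap : ∀ i, HasCompactSupport (lap i) := fun i => by
    refine (hcf i).of_isClosed_subset (isClosed_tsupport _)
      (closure_minimal ?_ (isClosed_tsupport _))
    intro x hx
    obtain ⟨k, -, hk⟩ := Finset.exists_ne_zero_of_sum_ne_zero hx
    have h1 : ∀ g : (Fin 3 → ℝ) → ℝ, tsupport (partialDeriv k g) ⊆ tsupport g :=
      fun g => tsupport_fderiv_apply_subset ℝ _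
    exact h1 _ (h1 _ (subset_tsupport _ hk))
  have hsq : ∀ {g : (Fin 3 → ℝ) → ℝ}, Continuous g → HasCompactSupport g →
      Integrable fun x => g x ^ 2 := fun hg hcg => by
    simp_rw [pow_two]
    exact (hg.mul hg).integrable_of_hasCompactSupport hcg.mul_left
  have hnn : ∀ g : (Fin 3 → ℝ) → ℝ, 0 ≤ ∫ x, g x ^ 2 :=
    fun g => integral_nonneg fun x => sq_nonneg _
  set D := ∫ x, ∑ i, ∑ j, partialDeriv j (f i) x ^ 2 with hD
  set L := ∫ x, ∑ i, lap i x ^ 2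
  have hDeq : D = ∑ i, ∑ j, ∫ x, partialDeriv j (f i) x ^ 2 := by
    have h : ∀ i j, Integrable fun x => partialDeriv j (f i) x ^ 2 :=
      fun i j => hsq (hpd i j).continuous (hcpd i j)
    rw [hD, integral_finsetSum _ fun i _ => integrable_finsetSum _ fun j _ => h i j]
    exact Finset.sum_congr rfl fun i _ => integral_finsetSum _ fun j _ => h i j
  have hLeq : L = ∑ i, ∫ x, lap i x ^ 2 :=
    integral_finsetSum _ fun i _ => hsq (hlap i) (hclap i)
  have hgrad : ∀ i, ∑ j, ∫ x, partialDeriv j (f i) x ^ 2 ≤ D := fun i =>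
    hDeq ▸ Finset.single_le_sum (f := fun i => ∑ j, ∫ x, partialDeriv j (f i) x ^ 2)
      (fun i _ => Finset.sum_nonneg fun j _ => hnn _) (Finset.mem_univ i)
  have hpart : ∀ i j, ∫ x, partialDeriv j (f i) x ^ 2 ≤ D := fun i j =>
    (Finset.single_le_sum (f := fun j => ∫ x, partialDeriv j (f i) x ^ 2)
      (fun j _ => hnn _) (Finset.mem_univ j)).trans (hgrad i)
  have hlapL : ∀ i, ∫ x, lap i x ^ 2 ≤ L := fun i =>
    hLeq ▸ Finset.single_le_sum (f := fun i => ∫ x, lap i x ^ 2)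
      (fun i _ => hnn _) (Finset.mem_univ i)
  have hhess : ∀ i j, ∑ k, ∫ x, partialDeriv k (partialDeriv j (f i)) x ^ 2 ≤ L := fun i j =>
    (Finset.single_le_sum
      (f := fun j => ∑ k, ∫ x, partialDeriv k (partialDeriv j (f i)) x ^ 2)
      (fun j _ => Finset.sum_nonneg fun k _ => hnn _) (Finset.mem_univ j)).trans
      ((sum_integral_sq_partialDeriv_partialDeriv (hf i) (hcf i)).trans_le (hlapL i))
  have hD0 : 0 ≤ D := (hnn _).trans (hpart 0 0)
  have hL0 : 0 ≤ L := (hnn _).trans (hlapL 0)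
  have hterm : ∀ i j, |∫ x, f j x * partialDeriv j (f i) x * lap i x| ≤
      K ^ (3 / 2 : ℝ) * D ^ (3 / 4 : ℝ) * L ^ (3 / 4 : ℝ) := fun i j => by
    rw [← sqrt_mul_interpolation_eq hK.le hD0 hL0, ← Real.norm_eq_abs, ← toReal_enorm]
    refine ENNReal.toReal_le_of_le_ofReal (by positivity) ?_
    refine (enorm_integral_le_lintegral_enorm _).trans ((lintegral_enorm_mul_mul_le
      (hf j).continuous.aemeasurable (hpd i j).continuous.aemeasurable
      (hlap i).aemeasurable).trans ?_)
    rw [ENNReal.ofReal_mul (by positivity), ENNReal.ofReal_mul (by positivity),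
      ENNReal.ofReal_mul (by positivity),
      ← ENNReal.ofReal_rpow_of_nonneg (by positivity) (by norm_num),
      ← ENNReal.ofReal_rpow_of_nonneg (by positivity) (by norm_num)]
    gcongr
    · exact hsob _ ((hf j).of_le (by norm_num)) (hcf j) _ (hgrad j)
    · rw [eLpNorm_two_eq_ofReal_sqrt
        ((hpd i j).continuous.memLp_of_hasCompactSupport (hcpd i j))]
      gcongr
      exact hpart i j
    · exact hsob _ (hpd i j) (hcpd i j) _ (hhess i j)
    · rw [eLpNorm_two_eq_ofReal_sqrt ((hlap i).memLp_of_hasCompactSupport (hclap i))]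
      gcongr
      exact hlapL i
  have hint : ∀ i j, Integrable fun x => f j x * partialDeriv j (f i) x * lap i x := fun i j =>
    (((hf j).continuous.mul (hpd i j).continuous).mul
      (hlap i)).integrable_of_hasCompactSupport (hclap i).mul_left
  rw [integral_finsetSum _ fun i _ => integrable_finsetSum _ fun j _ => hint i j]
  simp_rw [integral_finsetSum _ fun j _ => hint _ j]
  calc |∑ i, ∑ j, ∫ x, f j x * partialDeriv j (f i) x * lap i x|
      ≤ ∑ i, ∑ j, |∫ x, f j x * partialDeriv j (f i) x * lap i x| :=
        (Finset.abs_sum_le_sum_abs _ _).trans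
          (Finset.sum_le_sum fun i _ => Finset.abs_sum_le_sum_abs _ _)
    _ ≤ ∑ _i : Fin 3, ∑ _j : Fin 3, K ^ (3 / 2 : ℝ) * D ^ (3 / 4 : ℝ) * L ^ (3 / 4 : ℝ) :=
        Finset.sum_le_sum fun i _ => Finset.sum_le_sum fun j _ => hterm i j
    _ = 9 * K ^ (3 / 2 : ℝ) * D ^ (3 / 4 : ℝ) * L ^ (3 / 4 : ℝ) := by
        simp only [Finset.sum_const, Finset.card_univ, Fintype.card_fin, nsmul_eq_mul]
        ring
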